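/- arXiv:1910.03718 — 6 statements merged into one kernel-verified Lean document; each statement's English description precedes it below -/
import Mathlib

section
/- Laplace-transform bound for sums of independent random matrices (Proposition 3 in scalar-series form): for every θ > 0, E[exp(θ·μ(X_1 + ⋯ + X_K))] ≤ e^{−1} · Σ_{j=0}^∞ (1/j!) · Π_{k=1}^K E[(θ·μ(X_k) + 1)^j], where both sides are interpreted as values in [0, ∞] (expectations of nonnegative quantities). -/
open MeasureTheory ProbabilityTheory Finset
open scoped ENNReal

noncomputable instance matrixMeasurableSpace (m n : ℕ) :
    MeasurableSpace (Matrix (Fin m) (Fin n) ℂ) :=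
  inferInstanceAs (MeasurableSpace ((Fin m) → (Fin n) → ℂ))

/-- A Weierstrass product inequality. -/
theorem one_add_sum_le_prod_add_one {ι : Type*} (s : Finset ι) (a : ι → ℝ)
    (ha : ∀ i, 0 ≤ a i) : 1 + ∑ i ∈ s, a i ≤ ∏ i ∈ s, (a i + 1) := by
  classical
  induction s using Finset.induction_on with
  | empty => simp
  | insert i s hi ih =>
    rw [sum_insert hi, prod_insert hi]
    nlinarith [ha i, sum_nonneg fun j (_ : j ∈ s) => ha j,
      mul_le_mul_of_nonneg_left ih (ha i),
      mul_nonneg (ha i) (sum_nonneg fun j (_ : j ∈ s) => ha j)]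

theorem ENNReal.ofReal_exp_eq_tsum {x : ℝ} (hx : 0 ≤ x) :
    ENNReal.ofReal (Real.exp x) =
      ∑' j : ℕ, ((j.factorial : ℝ≥0∞))⁻¹ * ENNReal.ofReal (x ^ j) := by
  have h : HasSum (fun j : ℕ => x ^ j / j.factorial) (Real.exp x) := by
    rw [Real.exp_eq_exp_ℝ]
    exact NormedSpace.expSeries_div_hasSum_exp x
  rw [← h.tsum_eq, ENNReal.ofReal_tsum_of_nonneg (fun j => by positivity) h.summable]
  refine tsum_congr fun j => ?_
  rw [ENNReal.ofReal_div_of_pos (by positivity), ENNReal.ofReal_natCast, div_eq_mul_inv, mul_comm]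

theorem exp_sum_le_exp_neg_one_mul_tsum {ι : Type*} (s : Finset ι) (a : ι → ℝ)
    (ha : ∀ i, 0 ≤ a i) :
    ENNReal.ofReal (Real.exp (∑ i ∈ s, a i)) ≤ ENNReal.ofReal (Real.exp (-1)) *
      ∑' j : ℕ, ((j.factorial : ℝ≥0∞))⁻¹ * ∏ i ∈ s, ENNReal.ofReal ((a i + 1) ^ j) := by
  have h1 : ∀ i, 0 ≤ a i + 1 := fun i => add_nonneg (ha i) zero_le_one
  calc ENNReal.ofReal (Real.exp (∑ i ∈ s, a i))
      ≤ ENNReal.ofReal (Real.exp (-1) * Real.exp (∏ i ∈ s, (a i + 1))) := by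
        rw [← Real.exp_add]
        gcongr
        linarith [one_add_sum_le_prod_add_one s a ha]
    _ = _ := by
        rw [ENNReal.ofReal_mul (Real.exp_pos _).le,
          ENNReal.ofReal_exp_eq_tsum (prod_nonneg fun i _ => h1 i)]
        congr 1
        refine tsum_congr fun j => ?_
        rw [← prod_pow, ENNReal.ofReal_prod_of_nonneg fun i _ => pow_nonneg (h1 i) j]

/-- Laplace-transform bound for sums of independent random matrices
(Proposition 3 in scalar-series form). -/
theorem laplace_transform_bound
    (m n : ℕ) (hm : 0 < m) (hn : 0 < n)
    (μ : Matrix (Fin m) (Fin n) ℂ → ℝ)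
    (hC1 : ∀ A, 0 ≤ μ A)
    (hC2 : ∀ (θ : ℝ), 0 ≤ θ → ∀ A, μ (θ • A) = θ * μ A)
    (hC3 : ∀ A B, μ (A + B) ≤ μ A + μ B)
    (hμmeas : Measurable μ)
    {Ω' : Type*} [MeasureSpace Ω'] [IsProbabilityMeasure (ℙ : Measure Ω')]
    (K : ℕ) (hK : 0 < K)
    (X : Fin K → Ω' → Matrix (Fin m) (Fin n) ℂ)
    (hXmeas : ∀ k, Measurable (X k))
    (hindep : iIndepFun X ℙ)
    (θ : ℝ) (hθ : 0 < θ) :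
    ∫⁻ ω, ENNReal.ofReal (Real.exp (θ * μ (∑ k, X k ω))) ≤
      ENNReal.ofReal (Real.exp (-1)) *
        ∑' j : ℕ, ((j.factorial : ℝ≥0∞))⁻¹ *
          ∏ k, ∫⁻ ω, ENNReal.ofReal ((θ * μ (X k ω) + 1) ^ j) := by
  have hμ0 : μ 0 ≤ 0 := by simpa using (hC2 0 le_rfl 0).le
  have hf : ∀ j : ℕ, Measurable fun A => ENNReal.ofReal ((θ * μ A + 1) ^ j) :=
    fun j => by fun_prop
  have hfX : ∀ (j : ℕ) (k : Fin K),
      Measurable fun ω => ENNReal.ofReal ((θ * μ (X k ω) + 1) ^ j) :=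
    fun j k => (hf j).comp (hXmeas k)
  calc ∫⁻ ω, ENNReal.ofReal (Real.exp (θ * μ (∑ k, X k ω)))
      ≤ ∫⁻ ω, ENNReal.ofReal (Real.exp (-1)) * ∑' j : ℕ, ((j.factorial : ℝ≥0∞))⁻¹ *
          ∏ k, ENNReal.ofReal ((θ * μ (X k ω) + 1) ^ j) := by
        refine lintegral_mono fun ω => le_trans ?_ (exp_sum_le_exp_neg_one_mul_tsum univ
          (fun k => θ * μ (X k ω)) fun k => mul_nonneg hθ.le (hC1 _))
        rw [← mul_sum]
        gcongr
        exact le_sum_of_subadditive μ hμ0 hC3 univ fun k => X k ω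
    _ = _ := by
        rw [lintegral_const_mul' _ _ ENNReal.ofReal_ne_top,
          lintegral_tsum fun j => ((measurable_prod univ fun k _ => hfX j k).const_mul
            _).aemeasurable]
        congr 1
        refine tsum_congr fun j => ?_
        rw [lintegral_const_mul _ (measurable_prod univ fun k _ => hfX j k)]
        congr 1
        exact lintegral_prod_eq_prod_lintegral_of_indepFun univ _
          (hindep.comp _ fun _ => hf j) (hfX j)
end

section
/- Master dimension-free tail inequality (Proposition 4): for every t > 0 and every θ > 0, P{ μ(X_1 + ⋯ + X_K) ≥ t } ≤ exp(−θ·t + max(θ, θ^K) · φ), where φ = (max_{1≤k≤K} μ(B_k) + 1)^K − 1. (Consequently the bound holds with the infimum over θ > 0 on the right-hand side.) -/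
open MeasureTheory ProbabilityTheory Finset
open scoped ENNReal

/-- If the moments of `Y + 1` are bounded by the powers of `b + 1`, then `Y` almost surely
stays below every `c > b`. -/
theorem measure_ge_eq_zero_of_moment_le {Ω : Type*} [MeasurableSpace Ω] {P : Measure Ω}
    {Y : Ω → ℝ} (hY : Measurable Y) {b c : ℝ} (hb : 0 ≤ b) (hbc : b < c)
    (h : ∀ j : ℕ, ∫⁻ ω, ENNReal.ofReal ((Y ω + 1) ^ j) ∂P ≤ ENNReal.ofReal ((b + 1) ^ j)) :
    P {ω | c ≤ Y ω} = 0 := by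
  have hc : 0 < c + 1 := by linarith
  have hbound (j : ℕ) : P {ω | c ≤ Y ω} ≤ ENNReal.ofReal ((b + 1) / (c + 1)) ^ j := by
    have hpos : 0 < (c + 1) ^ j := pow_pos hc j
    have hmarkov := mul_meas_ge_le_lintegral (μ := P)
      (f := fun ω => ENNReal.ofReal ((Y ω + 1) ^ j)) (by fun_prop)
      (ENNReal.ofReal ((c + 1) ^ j))
    have hsub : {ω | c ≤ Y ω} ⊆
        {ω | ENNReal.ofReal ((c + 1) ^ j) ≤ ENNReal.ofReal ((Y ω + 1) ^ j)} := by
      intro ω (hω : c ≤ Y ω)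
      exact ENNReal.ofReal_le_ofReal (pow_le_pow_left₀ hc.le (by linarith) j)
    rw [← ENNReal.ofReal_pow (by positivity), div_pow, ENNReal.ofReal_div_of_pos hpos,
      ENNReal.le_div_iff_mul_le (Or.inl (by simpa using hpos)) (Or.inl ENNReal.ofReal_ne_top),
      mul_comm]
    calc _ ≤ _ := by gcongr
      _ ≤ _ := hmarkov.trans (h j)
  have hlt : ENNReal.ofReal ((b + 1) / (c + 1)) < 1 := by
    rw [ENNReal.ofReal_lt_one, div_lt_one hc]
    linarith
  exact le_antisymm (ge_of_tendsto' (ENNReal.tendsto_pow_atTop_nhds_zero_of_lt_one hlt) hbound)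
    zero_le

/-- Master dimension-free tail inequality (Proposition 4):
for every `t > 0` and `θ > 0`,
`P{ μ(X₁+⋯+X_K) ≥ t } ≤ exp(-θt + max(θ, θ^K) · φ)` where
`φ = (max_k μ(B_k) + 1)^K - 1`. -/
theorem master_tail_inequality
    (m n : ℕ) (hm : 0 < m) (hn : 0 < n)
    (μ : Matrix (Fin m) (Fin n) ℂ → ℝ)
    (hC1 : ∀ A, 0 ≤ μ A)
    (hC2 : ∀ (θ : ℝ), 0 ≤ θ → ∀ A, μ (θ • A) = θ * μ A)
    (hC3 : ∀ A B, μ (A + B) ≤ μ A + μ B)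
    (hμmeas : Measurable μ)
    {Ω' : Type*} [MeasureSpace Ω'] [IsProbabilityMeasure (ℙ : Measure Ω')]
    (K : ℕ) (hK : 0 < K)
    (X : Fin K → Ω' → Matrix (Fin m) (Fin n) ℂ)
    (hXmeas : ∀ k, Measurable (X k))
    (hindep : iIndepFun X ℙ)
    (B : Fin K → Matrix (Fin m) (Fin n) ℂ)
    (hdom : ∀ θ : ℝ, 0 < θ → ∀ j : ℕ, ∀ k,
      ∫⁻ ω, ENNReal.ofReal ((θ * μ (X k ω) + 1) ^ j) ≤
        ENNReal.ofReal ((θ * μ (B k) + 1) ^ j))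
    (φ : ℝ)
    (hφdef : φ =
      ((Finset.univ.sup' (Finset.univ_nonempty_iff.mpr ⟨⟨0, hK⟩⟩)
        fun k => μ (B k)) + 1) ^ K - 1)
    (t : ℝ) (ht : 0 < t) (θ : ℝ) (hθ : 0 < θ) :
    ℙ {ω | t ≤ μ (∑ k, X k ω)} ≤
      ENNReal.ofReal (Real.exp (-(θ * t) + max θ (θ ^ K) * φ)) := by
  set M := Finset.univ.sup' (Finset.univ_nonempty_iff.mpr ⟨⟨0, hK⟩⟩) fun k => μ (B k) with hM
  have hBM (k : Fin K) : μ (B k) ≤ M := Finset.le_sup' (fun k => μ (B k)) (Finset.mem_univ k)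
  have hM0 : 0 ≤ M := (hC1 _).trans (hBM ⟨0, hK⟩)
  have hKpos : (0 : ℝ) < K := by exact_mod_cast hK
  have hbern : K * M ≤ φ := by
    have := one_add_mul_le_pow (a := M) (by linarith) K
    rw [hφdef, add_comm M 1]
    linarith
  rcases le_or_gt t (K * M) with htM | htM
  · refine prob_le_one.trans ?_
    rw [ENNReal.one_le_ofReal, Real.one_le_exp_iff]
    have hφ0 : 0 ≤ φ := ht.le.trans (htM.trans hbern)
    have h1 : θ * t ≤ θ * φ := mul_le_mul_of_nonneg_left (htM.trans hbern) hθ.le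
    have h2 : θ * φ ≤ max θ (θ ^ K) * φ := mul_le_mul_of_nonneg_right (le_max_left _ _) hφ0
    linarith
  · have hMt : M < t / K := by rwa [lt_div_iff₀ hKpos, mul_comm]
    have hμ0 : μ 0 = 0 := by simpa using hC2 0 le_rfl 0
    have hsub : {ω | t ≤ μ (∑ k, X k ω)} ⊆ ⋃ k, {ω | t / K ≤ μ (X k ω)} := by
      intro ω (hω : t ≤ μ (∑ k, X k ω))
      by_contra hnot
      simp only [Set.mem_iUnion, Set.mem_ofPred_eq, not_exists, not_le] at hnot
      have hlt : ∑ k, μ (X k ω) < ∑ _k : Fin K, t / K :=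
        Finset.sum_lt_sum_of_nonempty (Finset.univ_nonempty_iff.mpr ⟨⟨0, hK⟩⟩)
          fun k _ => hnot k
      rw [Finset.sum_const, Finset.card_univ, Fintype.card_fin, nsmul_eq_mul,
        mul_div_cancel₀ _ hKpos.ne'] at hlt
      exact (hω.trans (Finset.le_sum_of_subadditive μ hμ0.le hC3 _ _)).not_gt hlt
    have hzero : ℙ (⋃ k, {ω | t / K ≤ μ (X k ω)}) = 0 :=
      measure_iUnion_null fun k =>
        measure_ge_eq_zero_of_moment_le (hμmeas.comp (hXmeas k)) (hC1 (B k))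
          ((hBM k).trans_lt hMt) fun j => by simpa using hdom 1 one_pos j k
    rw [measure_mono_null hsub hzero]
    exact zero_le
end

section
/- Dimension-free Bennett-type tail inequality (Theorem 1, first inequality of eq. (14)): assume φ > 0, where φ = (max_{1≤k≤K} μ(B_k) + 1)^K − 1. Then for every t > 0, P{ μ(X_1 + ⋯ + X_K) ≥ t } ≤ exp((1 + α1(K)) · φ) · exp(−φ · Γ(t/(K·φ))). -/
open MeasureTheory ProbabilityTheory Finset
open scoped ENNReal

/-- If the `j`-th moment of `f` is at most `c ^ j` for all `j`, then `f` stays below any `d > c`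
almost surely. -/
theorem measure_le_eq_zero_of_moments_le {Ω : Type*} [MeasurableSpace Ω] {P : Measure Ω}
    {f : Ω → ℝ} {c d : ℝ} (hc : 0 ≤ c) (hcd : c < d)
    (h : ∀ j : ℕ, ∫⁻ ω, ENNReal.ofReal (f ω ^ j) ∂P ≤ ENNReal.ofReal (c ^ j))
    (hf : Measurable f) :
    P {ω | d ≤ f ω} = 0 := by
  have hd : 0 < d := hc.trans_lt hcd
  have key : ∀ j : ℕ, P {ω | d ≤ f ω} ≤ ENNReal.ofReal ((c / d) ^ j) := by
    intro j
    have hsub : {ω | d ≤ f ω} ⊆ {ω | ENNReal.ofReal (d ^ j) ≤ ENNReal.ofReal (f ω ^ j)} :=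
      fun ω hω => ENNReal.ofReal_le_ofReal (pow_le_pow_left₀ hd.le hω j)
    have hpos : 0 < d ^ j := pow_pos hd j
    calc P {ω | d ≤ f ω}
        ≤ P {ω | ENNReal.ofReal (d ^ j) ≤ ENNReal.ofReal (f ω ^ j)} := measure_mono hsub
      _ ≤ (∫⁻ ω, ENNReal.ofReal (f ω ^ j) ∂P) / ENNReal.ofReal (d ^ j) :=
        meas_ge_le_lintegral_div (hf.pow_const j).ennreal_ofReal.aemeasurable
          (by simpa using hpos) ENNReal.ofReal_ne_top
      _ ≤ ENNReal.ofReal (c ^ j) / ENNReal.ofReal (d ^ j) := by gcongr; exact h j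
      _ = ENNReal.ofReal ((c / d) ^ j) := by
        rw [← ENNReal.ofReal_div_of_pos hpos, div_pow]
  have hlim : Filter.Tendsto (fun j : ℕ => ENNReal.ofReal ((c / d) ^ j)) Filter.atTop
      (nhds 0) := by
    simpa using ENNReal.tendsto_ofReal
      (tendsto_pow_atTop_nhds_zero_of_lt_one (div_nonneg hc hd.le) ((div_lt_one hd).2 hcd))
  exact le_antisymm (ge_of_tendsto' hlim key) bot_le

/-- The function `u ↦ u log u - u` is monotone on `[1, ∞)`. -/
theorem mul_log_sub_self_le {u v : ℝ} (hu : 1 ≤ u) (huv : u ≤ v) :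
    u * Real.log u - u ≤ v * Real.log v - v := by
  have hu0 : 0 < u := by linarith
  have hv0 : 0 < v := by linarith
  have h1 := Real.log_le_sub_one_of_pos (div_pos hu0 hv0)
  rw [Real.log_div hu0.ne' hv0.ne'] at h1
  have h2 : v * (Real.log u - Real.log v) ≤ u - v := by
    calc v * (Real.log u - Real.log v) ≤ v * (u / v - 1) := by gcongr
      _ = u - v := by field_simp
  nlinarith [mul_nonneg (sub_nonneg.2 huv) (Real.log_nonneg hu)]

/-- Dimension-free Bennett-type tail inequality (Theorem 1, first inequality of eq. (14)):
`P{ μ(X₁+⋯+X_K) ≥ t } ≤ exp((1 + α₁(K))·φ) · exp(-φ·Γ(t/(K·φ)))` where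
`φ = (max_k μ(B_k) + 1)^K - 1`, `Γ(x) = (1+x)log(1+x) - x`, and
`α₁(K) = ((K+1)/K)(log((K+1)/K) - 1)`. -/
theorem bennett_tail_inequality
    (m n : ℕ) (hm : 0 < m) (hn : 0 < n)
    (μ : Matrix (Fin m) (Fin n) ℂ → ℝ)
    (hC1 : ∀ A, 0 ≤ μ A)
    (hC2 : ∀ (θ : ℝ), 0 ≤ θ → ∀ A, μ (θ • A) = θ * μ A)
    (hC3 : ∀ A B, μ (A + B) ≤ μ A + μ B)
    (hμmeas : Measurable μ)
    {Ω' : Type*} [MeasureSpace Ω'] [IsProbabilityMeasure (ℙ : Measure Ω')]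
    (K : ℕ) (hK : 0 < K)
    (X : Fin K → Ω' → Matrix (Fin m) (Fin n) ℂ)
    (hXmeas : ∀ k, Measurable (X k))
    (hindep : iIndepFun X ℙ)
    (B : Fin K → Matrix (Fin m) (Fin n) ℂ)
    (hdom : ∀ θ : ℝ, 0 < θ → ∀ j : ℕ, ∀ k,
      ∫⁻ ω, ENNReal.ofReal ((θ * μ (X k ω) + 1) ^ j) ≤
        ENNReal.ofReal ((θ * μ (B k) + 1) ^ j))
    (φ : ℝ)
    (hφdef : φ =
      ((Finset.univ.sup' (Finset.univ_nonempty_iff.mpr ⟨⟨0, hK⟩⟩)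
        fun k => μ (B k)) + 1) ^ K - 1)
    (hφ : 0 < φ)
    (α₁ : ℝ) (hα₁ : α₁ = ((K + 1 : ℝ) / K) * (Real.log ((K + 1 : ℝ) / K) - 1))
    (t : ℝ) (ht : 0 < t) :
    ℙ {ω | t ≤ μ (∑ k, X k ω)} ≤
      ENNReal.ofReal (Real.exp ((1 + α₁) * φ) *
        Real.exp (-(φ * ((1 + t / (K * φ)) * Real.log (1 + t / (K * φ)) -
          t / (K * φ))))) := by
  set b : ℝ := Finset.univ.sup' (Finset.univ_nonempty_iff.mpr ⟨⟨0, hK⟩⟩) fun k => μ (B k)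
  have hBb : ∀ k, μ (B k) ≤ b := fun k => Finset.le_sup' (fun k => μ (B k)) (Finset.mem_univ k)
  have hb0 : 0 ≤ b := (hC1 _).trans (hBb ⟨0, hK⟩)
  have hK0 : (0 : ℝ) < K := by exact_mod_cast hK
  have hsum : ∀ ω, μ (∑ k, X k ω) ≤ ∑ k, μ (X k ω) := fun ω =>
    Finset.le_sum_of_subadditive μ (by simpa using (hC2 0 le_rfl 0).le) hC3 _ _
  rcases lt_or_ge (K * b) t with hlt | hle
  · have hbt : b < t / K := by rw [lt_div_iff₀ hK0]; linarith
    have hnull : ∀ k, ℙ {ω | t / K + 1 ≤ μ (X k ω) + 1} = 0 := fun k =>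
      measure_le_eq_zero_of_moments_le (c := μ (B k) + 1) (by linarith [hC1 (B k)])
        (by linarith [hBb k]) (fun j => by simpa using hdom 1 one_pos j k)
        ((hμmeas.comp (hXmeas k)).add_const 1)
    have hsub : {ω | t ≤ μ (∑ k, X k ω)} ⊆ ⋃ k, {ω | t / K + 1 ≤ μ (X k ω) + 1} := by
      intro ω hω
      by_contra hcon
      simp only [Set.mem_iUnion, Set.mem_ofPred_eq, not_exists, not_le] at hcon hω
      have hs : ∑ k, μ (X k ω) < ∑ _k : Fin K, t / K :=
        Finset.sum_lt_sum_of_nonempty (Finset.univ_nonempty_iff.mpr ⟨⟨0, hK⟩⟩)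
          fun k _ => by linarith [hcon k]
      have ht' : ∑ _k : Fin K, t / K = t := by
        simp only [Finset.sum_const, Finset.card_univ, Fintype.card_fin, nsmul_eq_mul]
        field_simp
      linarith [hsum ω]
    rw [measure_mono_null hsub (measure_iUnion_null hnull)]
    exact bot_le
  · have hbern : K * b ≤ φ := by
      have := one_add_mul_le_pow (show (-2 : ℝ) ≤ b by linarith) K
      rw [hφdef, add_comm b 1]
      linarith
    have hx0 : 0 ≤ t / (K * φ) := by positivity
    have hx : t / (K * φ) ≤ 1 / K := by
      rw [div_le_div_iff₀ (by positivity) hK0]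
      nlinarith
    have hmono := mul_log_sub_self_le (u := 1 + t / (K * φ)) (v := (K + 1 : ℝ) / K)
      (by linarith) (by rw [add_div, div_self hK0.ne']; linarith)
    have hexp : 0 ≤ (1 + α₁) * φ + -(φ * ((1 + t / (K * φ)) * Real.log (1 + t / (K * φ)) -
        t / (K * φ))) := by
      have hmul := mul_nonneg hφ.le (sub_nonneg.2 hmono)
      rw [hα₁]
      linarith
    refine prob_le_one.trans ?_
    rw [← Real.exp_add, ENNReal.one_le_ofReal]
    exact Real.one_le_exp hexp
end

section
/- Dimension-free Azuma–Hoeffding-type tail inequality (Theorem 3): assume every block Ω_i of the partition has at most two elements and φ_Ω > 0. Then for every t > 0, P{ μ(X_1 + ⋯ + X_K) ≥ t } ≤ exp(φ_Ω/4) · exp(−t²/(4·φ_Ω)). -/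
open MeasureTheory ProbabilityTheory Finset
open scoped ENNReal

/-- A random variable whose shifted moments are all dominated by the powers of a positive constant
is almost surely bounded by that constant. -/
lemma ae_le_of_forall_lintegral_pow_le {α : Type*} [MeasurableSpace α] {P : Measure α}
    [IsFiniteMeasure P] {Y : α → ℝ} (hY : Measurable Y) {b : ℝ} (hb : 0 < b)
    (h : ∀ j : ℕ, ∫⁻ ω, ENNReal.ofReal (Y ω ^ j) ∂P ≤ ENNReal.ofReal (b ^ j)) :
    ∀ᵐ ω ∂P, Y ω ≤ b := by
  have null_of_lt : ∀ c : ℝ, b < c → P {ω | c ≤ Y ω} = 0 := by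
    intro c hc
    have hc0 : 0 < c := hb.trans hc
    have tail_le : ∀ j : ℕ, P.real {ω | c ≤ Y ω} ≤ (b / c) ^ j := by
      intro j
      have markov : ENNReal.ofReal (c ^ j) * P {ω | c ≤ Y ω} ≤ ENNReal.ofReal (b ^ j) := by
        refine le_trans ?_ (h j)
        refine le_trans ?_ (mul_meas_ge_le_lintegral
          (hY.pow_const j).ennreal_ofReal (ENNReal.ofReal (c ^ j)))
        gcongr with ω
        intro hω
        exact ENNReal.ofReal_le_ofReal (pow_le_pow_left₀ hc0.le hω j)
      rw [← ofReal_measureReal, ← ENNReal.ofReal_mul (by positivity),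
        ENNReal.ofReal_le_ofReal_iff (by positivity)] at markov
      rw [div_pow, le_div_iff₀ (by positivity), mul_comm]
      exact markov
    have tendsto_zero := tendsto_pow_atTop_nhds_zero_of_lt_one (by positivity : 0 ≤ b / c)
      ((div_lt_one hc0).2 hc)
    exact (measureReal_eq_zero_iff).1
      (le_antisymm (ge_of_tendsto' tendsto_zero tail_le) measureReal_nonneg)
  have ae_lt : ∀ᵐ ω ∂P, ∀ n : ℕ, Y ω < b + 1 / ((n : ℝ) + 1) := by
    rw [ae_all_iff]
    intro n
    rw [ae_iff]
    simpa only [not_lt] using null_of_lt _ (lt_add_of_pos_right b Nat.one_div_pos_of_nat)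
  filter_upwards [ae_lt] with ω hω
  refine le_of_forall_pos_le_add fun ε hε => ?_
  obtain ⟨n, hn⟩ := exists_nat_one_div_lt hε
  linarith [hω n]

/-- Bernoulli's inequality summed over the blocks of a partition. -/
lemma sum_le_sum_sup'_add_one_pow_sub_one {ι κ : Type*} [Fintype ι] [Fintype κ] [DecidableEq κ]
    (s : ι → Finset κ) (hne : ∀ i, (s i).Nonempty)
    (hdisj : ∀ i j, i ≠ j → Disjoint (s i) (s j)) (hcover : ∀ k, ∃ i, k ∈ s i)
    (f : κ → ℝ) (hf : ∀ k, 0 ≤ f k) :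
    ∑ k, f k ≤ ∑ i, (((s i).sup' (hne i) f + 1) ^ (s i).card - 1) := by
  have univ_eq : (Finset.univ : Finset κ) = Finset.univ.biUnion s := by
    ext k
    simpa using hcover k
  calc ∑ k, f k = ∑ i, ∑ k ∈ s i, f k := by
        rw [univ_eq]
        exact Finset.sum_biUnion fun i _ j _ hij => hdisj i j hij
    _ ≤ _ := by
        refine Finset.sum_le_sum fun i _ => ?_
        have sum_le : ∑ k ∈ s i, f k ≤ (s i).card • (s i).sup' (hne i) f :=
          Finset.sum_le_card_nsmul _ _ _ fun k hk => Finset.le_sup' f hk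
        obtain ⟨k, hk⟩ := hne i
        have sup_nonneg : 0 ≤ (s i).sup' (hne i) f := (hf k).trans (Finset.le_sup' f hk)
        have bernoulli := one_add_mul_le_pow (by linarith : -2 ≤ (s i).sup' (hne i) f) (s i).card
        rw [nsmul_eq_mul] at sum_le
        rw [add_comm _ (1 : ℝ)]
        linarith

/-- Dimension-free Azuma–Hoeffding-type tail inequality (Theorem 3):
if every block of the partition has at most two elements and `φ_Ω > 0`, then
`P{ μ(X₁+⋯+X_K) ≥ t } ≤ exp(φ_Ω/4) · exp(-t²/(4·φ_Ω))`. -/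
theorem azuma_hoeffding_tail_inequality
    (m n : ℕ) (hm : 0 < m) (hn : 0 < n)
    (μ : Matrix (Fin m) (Fin n) ℂ → ℝ)
    (hC1 : ∀ A, 0 ≤ μ A)
    (hC2 : ∀ (θ : ℝ), 0 ≤ θ → ∀ A, μ (θ • A) = θ * μ A)
    (hC3 : ∀ A B, μ (A + B) ≤ μ A + μ B)
    (hμmeas : Measurable μ)
    {Ω' : Type*} [MeasureSpace Ω'] [IsProbabilityMeasure (ℙ : Measure Ω')]
    (K : ℕ) (hK : 0 < K)
    (X : Fin K → Ω' → Matrix (Fin m) (Fin n) ℂ)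
    (hXmeas : ∀ k, Measurable (X k))
    (hindep : iIndepFun X ℙ)
    (B : Fin K → Matrix (Fin m) (Fin n) ℂ)
    (hdom : ∀ θ : ℝ, 0 < θ → ∀ j : ℕ, ∀ k,
      ∫⁻ ω, ENNReal.ofReal ((θ * μ (X k ω) + 1) ^ j) ≤
        ENNReal.ofReal ((θ * μ (B k) + 1) ^ j))
    (I : ℕ) (Part : Fin I → Finset (Fin K))
    (hne : ∀ i, (Part i).Nonempty)
    (hdisj : ∀ i j, i ≠ j → Disjoint (Part i) (Part j))
    (hcover : ∀ k, ∃ i, k ∈ Part i)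
    (τ : ℕ) (hτ : τ = Finset.univ.sup fun i => (Part i).card)
    (φΩ : ℝ)
    (hφΩ : φΩ = ∑ i, ((((Part i).sup' (hne i) fun k => μ (B k)) + 1) ^
      (Part i).card - 1))
    (hsmall : ∀ i, (Part i).card ≤ 2)
    (hφΩpos : 0 < φΩ)
    (t : ℝ) (ht : 0 < t) :
    ℙ {ω | t ≤ μ (∑ k, X k ω)} ≤
      ENNReal.ofReal (Real.exp (φΩ / 4) * Real.exp (-(t ^ 2 / (4 * φΩ)))) := by
  rw [← Real.exp_add]
  rcases le_or_gt t φΩ with htφ | htφ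
  · refine prob_le_one.trans ?_
    rw [ENNReal.one_le_ofReal, Real.one_le_exp_iff, ← sub_eq_add_neg, sub_nonneg,
      div_le_div_iff₀ (by positivity) (by positivity)]
    nlinarith
  · have hbound : ∀ᵐ ω, ∀ k, μ (X k ω) + 1 ≤ μ (B k) + 1 := by
      rw [ae_all_iff]
      intro k
      refine ae_le_of_forall_lintegral_pow_le ((hμmeas.comp (hXmeas k)).add_const 1)
        (by linarith [hC1 (B k)]) fun j => ?_
      simpa using hdom 1 one_pos j k
    have hzero : μ 0 = 0 := by simpa using hC2 0 le_rfl 0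
    have hsumB : ∑ k, μ (B k) ≤ φΩ :=
      hφΩ ▸ sum_le_sum_sup'_add_one_pow_sub_one Part hne hdisj hcover _ fun k => hC1 (B k)
    have hlt : ∀ᵐ ω, ¬ t ≤ μ (∑ k, X k ω) := by
      filter_upwards [hbound] with ω hω
      have hsub : μ (∑ k, X k ω) ≤ ∑ k, μ (X k ω) :=
        Finset.le_sum_of_subadditive μ hzero.le hC3 _ _
      have hsumX : ∑ k, μ (X k ω) ≤ ∑ k, μ (B k) :=
        Finset.sum_le_sum fun k _ => by linarith [hω k]
      linarith
    rw [ae_iff] at hlt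
    simp only [not_not] at hlt
    rw [hlt]
    exact zero_le
end

section
/- Empirical selection of dominating matrices (Theorem 4): fix θ > 0 and γ > 0, and assume 0 < E[(log(θ·μ(X)+1))²] < ∞. Let B_γ be any random m×n complex matrix, measurable with respect to the sample X^{(1)}, …, X^{(N)}, such that almost surely μ(B_γ) ≥ (1/N)·Σ_{n=1}^N μ(X^{(n)}) + γ·exp((1/N)·Σ_{n=1}^N log(θ·μ(X^{(n)})+1)). Then P{ E[log(θ·μ(X)+1)] > log(θ·μ(B_γ)+1) } ≤ exp( −N·(log(1+θ·γ))² / (2·E[(log(θ·μ(X)+1))²]) ). -/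
open MeasureTheory ProbabilityTheory Finset
open scoped ENNReal

theorem Real.exp_neg_le_quadratic {x : ℝ} (hx : 0 ≤ x) :
    Real.exp (-x) ≤ 1 - x + x ^ 2 / 2 := by
  rw [Real.exp_neg]
  refine inv_le_of_inv_le₀ (by nlinarith [sq_nonneg (x - 1)]) ?_
  refine le_trans ?_ (Real.quadratic_le_exp_of_nonneg hx)
  rw [inv_le_iff_one_le_mul₀ (by nlinarith [sq_nonneg (x - 1)])]
  nlinarith [sq_nonneg (x ^ 2)]

theorem integrable_exp_neg_mul_of_nonneg {Ω : Type*} [MeasurableSpace Ω] {P : Measure Ω}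
    [IsFiniteMeasure P] {Y : Ω → ℝ} (hY : AEMeasurable Y P) (hY0 : ∀ ω, 0 ≤ Y ω)
    {s : ℝ} (hs : 0 ≤ s) : Integrable (fun ω => Real.exp (-s * Y ω)) P := by
  refine Integrable.of_bound (C := 1)
    (Real.measurable_exp.comp_aemeasurable (hY.const_mul _)).aestronglyMeasurable ?_
  refine .of_forall fun ω => ?_
  rw [Real.norm_eq_abs, Real.abs_exp, Real.exp_le_one_iff]
  nlinarith [mul_nonneg hs (hY0 ω)]

theorem mgf_neg_le_exp_of_nonneg {Ω : Type*} [MeasurableSpace Ω] {P : Measure Ω}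
    [IsProbabilityMeasure P] {Y : Ω → ℝ} (hY0 : ∀ ω, 0 ≤ Y ω) (hint : Integrable Y P)
    (hint2 : Integrable (fun ω => Y ω ^ 2) P) {s : ℝ} (hs : 0 ≤ s) :
    mgf Y P (-s) ≤ Real.exp (-s * ∫ ω, Y ω ∂P + s ^ 2 / 2 * ∫ ω, Y ω ^ 2 ∂P) := by
  have h1 : Integrable (fun ω => -s * Y ω) P := hint.const_mul _
  have h2 : Integrable (fun ω => s ^ 2 / 2 * Y ω ^ 2) P := hint2.const_mul _
  have h12 : Integrable (fun ω => -s * Y ω + s ^ 2 / 2 * Y ω ^ 2) P := h1.add h2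
  calc mgf Y P (-s)
      ≤ ∫ ω, (-s * Y ω + s ^ 2 / 2 * Y ω ^ 2) + 1 ∂P := by
        refine integral_mono (integrable_exp_neg_mul_of_nonneg hint.aemeasurable hY0 hs)
          (h12.add (integrable_const 1)) fun ω => ?_
        have := Real.exp_neg_le_quadratic (mul_nonneg hs (hY0 ω))
        rw [← neg_mul] at this
        dsimp only
        linarith
    _ = (-s * ∫ ω, Y ω ∂P + s ^ 2 / 2 * ∫ ω, Y ω ^ 2 ∂P) + 1 := by
        rw [integral_add h12 (integrable_const 1), integral_add h1 h2,
          integral_const_mul, integral_const_mul]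
        simp
    _ ≤ _ := Real.add_one_le_exp _

/-- Lower-tail bound for the sum of independent copies `Ys i` of a nonnegative square-integrable
random variable `Y`. -/
theorem measureReal_sum_le_lower_tail {Ω : Type*} [MeasurableSpace Ω] {P : Measure Ω}
    [IsProbabilityMeasure P] {N : ℕ} {Y : Ω → ℝ} {Ys : Fin N → Ω → ℝ}
    (hY0 : ∀ ω, 0 ≤ Y ω) (hint : Integrable Y P) (hint2 : Integrable (fun ω => Y ω ^ 2) P)
    (hpos : 0 < ∫ ω, Y ω ^ 2 ∂P) (hYs : ∀ i, Measurable (Ys i)) (hYs0 : ∀ i ω, 0 ≤ Ys i ω)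
    (hindep : iIndepFun Ys P) (hident : ∀ i, IdentDistrib (Ys i) Y P P) {t : ℝ} (ht : 0 ≤ t) :
    P.real {ω | ∑ i, Ys i ω ≤ N * ((∫ ω, Y ω ∂P) - t)} ≤
      Real.exp (-(N : ℝ) * t ^ 2 / (2 * ∫ ω, Y ω ^ 2 ∂P)) := by
  set V := ∫ ω, Y ω ^ 2 ∂P with hV
  set M := ∫ ω, Y ω ∂P with hM
  have hs : 0 ≤ t / V := by positivity
  have hsum : Measurable (fun ω => ∑ i, Ys i ω) := Finset.measurable_sum _ fun i _ => hYs i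
  have hmgf : mgf (fun ω => ∑ i, Ys i ω) P (-(t / V)) = mgf Y P (-(t / V)) ^ N := by
    have h := hindep.mgf_sum (t := -(t / V)) hYs Finset.univ
    have hfun : (∑ i, Ys i) = fun ω => ∑ i, Ys i ω := by ext; simp
    rw [hfun] at h
    rw [h, Finset.prod_congr rfl fun i _ => congrFun (mgf_congr_identDistrib (hident i)) _]
    simp
  calc _ ≤ Real.exp (-(-(t / V)) * (N * (M - t))) * mgf (fun ω => ∑ i, Ys i ω) P (-(t / V)) :=
        measure_le_le_exp_mul_mgf _ (by linarith)
          (integrable_exp_neg_mul_of_nonneg hsum.aemeasurable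
            (fun ω => Finset.sum_nonneg fun i _ => hYs0 i ω) hs)
    _ ≤ Real.exp (-(-(t / V)) * (N * (M - t))) *
          Real.exp (-(t / V) * M + (t / V) ^ 2 / 2 * V) ^ N := by
        rw [hmgf]
        gcongr
        · exact mgf_nonneg
        · exact mgf_neg_le_exp_of_nonneg hY0 hint hint2 hs
    _ = _ := by
        rw [← Real.exp_nat_mul, ← Real.exp_add]
        congr 1
        field_simp
        ring

/-- The geometric mean of the numbers `1 + θ * a i` is at most their arithmetic mean, so adding
`γ` times the geometric mean to the average of the `a i` gains `log (1 + θ * γ)`. -/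
theorem mean_log_add_log_le {N : ℕ} (hN : 0 < N) {a : Fin N → ℝ} (ha : ∀ i, 0 ≤ a i)
    {θ γ b : ℝ} (hθ : 0 < θ) (hγ : 0 < γ)
    (hb : (1 / N : ℝ) * ∑ i, a i +
      γ * Real.exp ((1 / N : ℝ) * ∑ i, Real.log (θ * a i + 1)) ≤ b) :
    (1 / N : ℝ) * ∑ i, Real.log (θ * a i + 1) + Real.log (1 + θ * γ) ≤
      Real.log (θ * b + 1) := by
  have hN' : (N : ℝ) ≠ 0 := by positivity
  have hpos : ∀ i, 0 < θ * a i + 1 := fun i => by have := ha i; positivity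
  have hamgm : Real.exp ((1 / N : ℝ) * ∑ i, Real.log (θ * a i + 1)) ≤
      θ * ((1 / N : ℝ) * ∑ i, a i) + 1 := by
    have h := convexOn_exp.map_sum_le (t := Finset.univ) (w := fun _ : Fin N => (1 / N : ℝ))
      (p := fun i => Real.log (θ * a i + 1)) (fun _ _ => by positivity)
      (by simp [hN']) (fun _ _ => Set.mem_univ _)
    simp only [smul_eq_mul, Real.exp_log (hpos _), ← Finset.mul_sum] at h
    refine h.trans_eq ?_
    rw [Finset.sum_add_distrib, ← Finset.mul_sum]
    simp
    field_simp
  set E := (1 / N : ℝ) * ∑ i, Real.log (θ * a i + 1)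
  have hmul : Real.exp E * (1 + θ * γ) ≤ θ * b + 1 := by
    nlinarith [mul_le_mul_of_nonneg_left hb hθ.le]
  have hθγ : 0 < 1 + θ * γ := by positivity
  calc E + Real.log (1 + θ * γ) = Real.log (Real.exp E * (1 + θ * γ)) := by
        rw [Real.log_mul (Real.exp_pos _).ne' hθγ.ne', Real.log_exp]
    _ ≤ _ := Real.log_le_log (mul_pos (Real.exp_pos _) hθγ) hmul

/-- Empirical selection of dominating matrices (Theorem 4): if `B_γ` satisfies
`μ(B_γ) ≥ (1/N)·Σ μ(X⁽ⁿ⁾) + γ · exp((1/N)·Σ log(θ·μ(X⁽ⁿ⁾)+1))` a.s., then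
`P{ E[log(θ·μ(X)+1)] > log(θ·μ(B_γ)+1) } ≤
  exp(-N·(log(1+θγ))² / (2·E[(log(θ·μ(X)+1))²]))`. -/
theorem empirical_selection
    (m n : ℕ) (hm : 0 < m) (hn : 0 < n)
    (μ : Matrix (Fin m) (Fin n) ℂ → ℝ)
    (hC1 : ∀ A, 0 ≤ μ A)
    (hC2 : ∀ (θ : ℝ), 0 ≤ θ → ∀ A, μ (θ • A) = θ * μ A)
    (hC3 : ∀ A B, μ (A + B) ≤ μ A + μ B)
    (hμmeas : Measurable μ)
    {Ω' : Type*} [MeasureSpace Ω'] [IsProbabilityMeasure (ℙ : Measure Ω')]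
    (X : Ω' → Matrix (Fin m) (Fin n) ℂ) (hX : Measurable X)
    (N : ℕ) (hN : 0 < N)
    (Xs : Fin N → Ω' → Matrix (Fin m) (Fin n) ℂ)
    (hXsmeas : ∀ i, Measurable (Xs i))
    (hindep : iIndepFun Xs ℙ)
    (hident : ∀ i, Measure.map (Xs i) ℙ = Measure.map X ℙ)
    (θ : ℝ) (hθ : 0 < θ) (γ : ℝ) (hγ : 0 < γ)
    (hint1 : Integrable (fun ω => Real.log (θ * μ (X ω) + 1)))
    (hint2 : Integrable (fun ω => (Real.log (θ * μ (X ω) + 1)) ^ 2))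
    (hpos : 0 < ∫ ω, (Real.log (θ * μ (X ω) + 1)) ^ 2)
    (Bγ : Ω' → Matrix (Fin m) (Fin n) ℂ) (hBγmeas : Measurable Bγ)
    (hBγ : ∀ᵐ ω ∂(ℙ : Measure Ω'),
      (1 / N : ℝ) * ∑ i, μ (Xs i ω) +
        γ * Real.exp ((1 / N : ℝ) * ∑ i, Real.log (θ * μ (Xs i ω) + 1)) ≤
        μ (Bγ ω)) :
    ℙ {ω | Real.log (θ * μ (Bγ ω) + 1) <
        ∫ ω', Real.log (θ * μ (X ω') + 1)} ≤
      ENNReal.ofReal (Real.exp (-(N : ℝ) * (Real.log (1 + θ * γ)) ^ 2 /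
        (2 * ∫ ω', (Real.log (θ * μ (X ω') + 1)) ^ 2))) := by
  have hlog : Measurable fun A => Real.log (θ * μ A + 1) :=
    ((hμmeas.const_mul θ).add_const 1).log
  have hlog0 : ∀ A, 0 ≤ Real.log (θ * μ A + 1) := fun A =>
    Real.log_nonneg (by nlinarith [mul_nonneg hθ.le (hC1 A)])
  have htail := measureReal_sum_le_lower_tail (P := ℙ)
    (Ys := fun i ω => Real.log (θ * μ (Xs i ω) + 1)) (fun ω => hlog0 (X ω)) hint1 hint2 hpos
    (fun i => hlog.comp (hXsmeas i)) (fun i ω => hlog0 (Xs i ω))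
    (hindep.comp (fun _ A => Real.log (θ * μ A + 1)) fun _ => hlog)
    (fun i => IdentDistrib.comp
      ⟨(hXsmeas i).aemeasurable, hX.aemeasurable, hident i⟩ hlog)
    (t := Real.log (1 + θ * γ)) (Real.log_nonneg (by nlinarith [mul_pos hθ hγ]))
  refine le_trans (measure_mono_ae ?_) (ENNReal.le_ofReal_iff_toReal_le (measure_ne_top _ _)
    (Real.exp_pos _).le |>.2 htail)
  filter_upwards [hBγ] with ω hω hlt
  have hgain := mean_log_add_log_le hN (fun i => hC1 (Xs i ω)) hθ hγ hω
  have hmean : (1 / N : ℝ) * ∑ i, Real.log (θ * μ (Xs i ω) + 1) ≤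
      (∫ ω', Real.log (θ * μ (X ω') + 1)) - Real.log (1 + θ * γ) :=
    le_sub_iff_add_le.2 (hgain.trans (le_of_lt hlt))
  have hNpos : (0 : ℝ) < N := by positivity
  rwa [one_div, inv_mul_le_iff₀ hNpos] at hmean
end

section
/- Dimension-free expectation bound (Proposition 7): assume every block Ω_i of the partition has at most two elements. Then for every c > 0, E[μ(X_1 + ⋯ + X_K)] ≤ φ_Ω · ( √(2·α2(c)) + c·α2(c)/3 ), where α2(c) = 3·((c+3) − √(6c+9))/c². -/
open MeasureTheory ProbabilityTheory Finset
open scoped ENNReal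

/-- At the optimal value of `α₂`, the Bernstein-type factor is exactly one. -/
lemma sqrt_two_mul_add_mul_div_three_eq_one {c α : ℝ} (hc : 0 < c)
    (hα : α = 3 * ((c + 3) - Real.sqrt (6 * c + 9)) / c ^ 2) :
    Real.sqrt (2 * α) + c * α / 3 = 1 := by
  obtain ⟨s, hs⟩ : ∃ s, s = Real.sqrt (6 * c + 9) := ⟨_, rfl⟩
  have hsq : s ^ 2 = 6 * c + 9 := by rw [hs, Real.sq_sqrt (by positivity)]
  have hs0 : 0 ≤ s := hs ▸ Real.sqrt_nonneg _
  have hs3 : 0 < s - 3 := by nlinarith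
  have hcs : c = (s - 3) * (s + 3) / 6 := by linarith
  have hαs : α = 18 / (s + 3) ^ 2 := by
    rw [hα, ← hs, hcs]
    field_simp
    ring
  have hsqrt : Real.sqrt (2 * α) = 6 / (s + 3) := by
    rw [show 2 * α = (6 / (s + 3)) ^ 2 by rw [hαs, div_pow]; ring, Real.sqrt_sq (by positivity)]
  rw [hsqrt, hαs, hcs]
  field_simp
  ring

/-- The sum of a nonnegative function over a finite set is at most `(sup + 1) ^ card - 1`. -/
lemma sum_le_sup'_add_one_pow_card_sub_one {ι : Type*} (s : Finset ι) (hs : s.Nonempty)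
    (f : ι → ℝ) (hf : ∀ k, 0 ≤ f k) :
    ∑ k ∈ s, f k ≤ (s.sup' hs f + 1) ^ s.card - 1 := by
  have hsum : ∑ k ∈ s, f k ≤ s.card * s.sup' hs f := by
    simpa using Finset.sum_le_card_nsmul s f _ fun k hk => Finset.le_sup' f hk
  have hsup : 0 ≤ s.sup' hs f := by
    obtain ⟨k, hk⟩ := hs
    exact (hf k).trans (Finset.le_sup' f hk)
  have hbern := one_add_mul_le_pow (a := s.sup' hs f) (by linarith) s.card
  rw [add_comm 1 (s.sup' hs f)] at hbern
  linarith

/-- An additive shift by one can be cancelled in a bound on an expectation. -/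
lemma lintegral_ofReal_le_of_add_one {Ω : Type*} [MeasurableSpace Ω] (P : Measure Ω)
    [IsProbabilityMeasure P] {f : Ω → ℝ} {b : ℝ} (hf : ∀ ω, 0 ≤ f ω) (hb : 0 ≤ b)
    (h : ∫⁻ ω, ENNReal.ofReal (f ω + 1) ∂P ≤ ENNReal.ofReal (b + 1)) :
    ∫⁻ ω, ENNReal.ofReal (f ω) ∂P ≤ ENNReal.ofReal b := by
  simp_rw [fun ω => ENNReal.ofReal_add (hf ω) zero_le_one] at h
  rw [lintegral_add_right _ measurable_const, ENNReal.ofReal_add hb zero_le_one,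
    lintegral_const, measure_univ, mul_one] at h
  exact (ENNReal.add_le_add_iff_right ENNReal.ofReal_ne_top).1 h

/-- Dimension-free expectation bound (Proposition 7): if every block of the
partition has at most two elements, then for every `c > 0`,
`E[μ(X₁+⋯+X_K)] ≤ φ_Ω · (√(2·α₂(c)) + c·α₂(c)/3)` where
`α₂(c) = 3·((c+3) - √(6c+9))/c²`. -/
theorem expectation_bound
    (m n : ℕ) (hm : 0 < m) (hn : 0 < n)
    (μ : Matrix (Fin m) (Fin n) ℂ → ℝ)
    (hC1 : ∀ A, 0 ≤ μ A)
    (hC2 : ∀ (θ : ℝ), 0 ≤ θ → ∀ A, μ (θ • A) = θ * μ A)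
    (hC3 : ∀ A B, μ (A + B) ≤ μ A + μ B)
    (hμmeas : Measurable μ)
    {Ω' : Type*} [MeasureSpace Ω'] [IsProbabilityMeasure (ℙ : Measure Ω')]
    (K : ℕ) (hK : 0 < K)
    (X : Fin K → Ω' → Matrix (Fin m) (Fin n) ℂ)
    (hXmeas : ∀ k, Measurable (X k))
    (hindep : iIndepFun X ℙ)
    (B : Fin K → Matrix (Fin m) (Fin n) ℂ)
    (hdom : ∀ θ : ℝ, 0 < θ → ∀ j : ℕ, ∀ k,
      ∫⁻ ω, ENNReal.ofReal ((θ * μ (X k ω) + 1) ^ j) ≤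
        ENNReal.ofReal ((θ * μ (B k) + 1) ^ j))
    (I : ℕ) (Part : Fin I → Finset (Fin K))
    (hne : ∀ i, (Part i).Nonempty)
    (hdisj : ∀ i j, i ≠ j → Disjoint (Part i) (Part j))
    (hcover : ∀ k, ∃ i, k ∈ Part i)
    (τ : ℕ) (hτ : τ = Finset.univ.sup fun i => (Part i).card)
    (φΩ : ℝ)
    (hφΩ : φΩ = ∑ i, ((((Part i).sup' (hne i) fun k => μ (B k)) + 1) ^
      (Part i).card - 1))
    (hsmall : ∀ i, (Part i).card ≤ 2)
    (c : ℝ) (hc : 0 < c)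
    (α₂ : ℝ) (hα₂ : α₂ = 3 * ((c + 3) - Real.sqrt (6 * c + 9)) / c ^ 2) :
    ∫⁻ ω, ENNReal.ofReal (μ (∑ k, X k ω)) ≤
      ENNReal.ofReal (φΩ * (Real.sqrt (2 * α₂) + c * α₂ / 3)) := by
  have hμ0 : μ 0 = 0 := by simpa using hC2 0 le_rfl 0
  have hX (k : Fin K) : ∫⁻ ω, ENNReal.ofReal (μ (X k ω)) ≤ ENNReal.ofReal (μ (B k)) :=
    lintegral_ofReal_le_of_add_one ℙ (fun ω => hC1 _) (hC1 _)
      (by simpa using hdom 1 one_pos 1 k)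
  have hunion : (Finset.univ : Finset (Fin K)) = Finset.univ.biUnion Part := by
    ext k
    simpa using hcover k
  have hφ : ∑ k, μ (B k) ≤ φΩ := by
    rw [hφΩ, hunion, Finset.sum_biUnion fun i _ j _ hij => hdisj i j hij]
    exact Finset.sum_le_sum fun i _ =>
      sum_le_sup'_add_one_pow_card_sub_one (Part i) (hne i) (fun k => μ (B k)) fun k => hC1 _
  rw [sqrt_two_mul_add_mul_div_three_eq_one hc hα₂, mul_one]
  calc ∫⁻ ω, ENNReal.ofReal (μ (∑ k, X k ω))
      ≤ ∫⁻ ω, ∑ k, ENNReal.ofReal (μ (X k ω)) := by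
        refine lintegral_mono fun ω => ?_
        rw [← ENNReal.ofReal_sum_of_nonneg fun k _ => hC1 _]
        exact ENNReal.ofReal_le_ofReal (Finset.le_sum_of_subadditive μ hμ0.le hC3 _ _)
    _ = ∑ k, ∫⁻ ω, ENNReal.ofReal (μ (X k ω)) :=
        lintegral_finsetSum _ fun k _ => (hμmeas.comp (hXmeas k)).ennreal_ofReal
    _ ≤ ∑ k, ENNReal.ofReal (μ (B k)) := Finset.sum_le_sum fun k _ => hX k
    _ = ENNReal.ofReal (∑ k, μ (B k)) :=
        (ENNReal.ofReal_sum_of_nonneg fun k _ => hC1 _).symm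
    _ ≤ ENNReal.ofReal φΩ := ENNReal.ofReal_le_ofReal hφ
end
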